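/- Let N ≥ 3 be an integer, y₁ < y₂ < ⋯ < y_{2N} real numbers, and x ∈ (y_{2N−1}, y_{2N}). For u in the closed upper half-plane with u ∉ {y₁,…,y_{2N}}, let Π(u) = ∏_{j=1}^{2N} exp(½ Log(u − y_j)) (Log the principal branch). Let Q̃ be a monic polynomial of degree N−2 with real coefficients such that ∫_{y_{2i+1}}^{y_{2i+2}} Q̃(u) / (Π(u)·(u − x)²) du = 0 for every 1 ≤ i ≤ N−2. Set g(u) = Q̃(u)/Π(u), and define V(z) = ∫_{y₁}^{z} g(u) / (π · g(x) · (u − x)²) du for z ∈ ℍ, the integral being taken along any path from y₁ to z that lies in ℍ except for its starting point (the integral converges and is independent of the path). Then: (0) L := g′(x)/g(x) is a real number; (1) for each 1 ≤ i ≤ N−1, Im V extends continuously to (y_{2i−1}, y_{2i}) with constant boundary value; (2) Re V extends continuously to (−∞, y₁) ∪ (y_{2N}, +∞) with boundary value 0, and there is a constant c ∈ ℝ such that Re V extends continuously to (y_{2i}, y_{2i+1}) with boundary value identically c for every 1 ≤ i ≤ N−1; (3) z ↦ Im( V(z) + 1/(π(z − x)) ) is bounded on ℍ ∩ B(x, r)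 for some r > 0; (4) there exist real constants K₁ and K₂ such that Im( V(z) + 1/(π(z − x)) ) extends continuously to (y_{2N−1}, x) with boundary value identically K₁ and to (x, y_{2N}) with boundary value identically K₂, and K₁ = K₂ + L. -/

import Mathlib

open Set Metric Filter Complex Topology MeasureTheory intervalIntegral

noncomputable section

/-- The open upper half-plane in `ℂ`. -/
def UHP : Set ℂ := {z | 0 < z.im}

/-- The closed upper half-plane in `ℂ`. -/
def cUHP : Set ℂ := {z | 0 ≤ z.im}

/-- `sqrtProd N y u = ∏_{j=1}^{2N} (u - y_j)^{1/2}`, the branch defined via the principal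
logarithm, which is positive for real `u > y_{2N}`. -/
def sqrtProd (N : ℕ) (y : ℕ → ℝ) (u : ℂ) : ℂ :=
  ∏ j ∈ Finset.Icc 1 (2 * N), Complex.exp ((1 / 2 : ℂ) * Complex.log (u - (y j : ℂ)))


/-! ### Primitives -/

lemma UHP_isOpen : IsOpen UHP := isOpen_lt continuous_const Complex.continuous_im

lemma UHP_convex : Convex ℝ UHP := convex_halfSpace_im_gt 0

lemma cUHP_convex : Convex ℝ cUHP := convex_halfSpace_im_ge 0

lemma cUHP_subset_closure : cUHP ⊆ closure UHP := by
  have : closure UHP = cUHP := by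
    have := Complex.closure_setOfPred_lt_im 0
    exact this
  rw [this]

lemma primitive_UHP (f : ℂ → ℂ) (hf : DifferentiableOn ℂ f UHP) :
    ∃ V : ℂ → ℂ, ∀ z ∈ UHP, HasDerivAt V (f z) z := by
  have hne : ∀ w ∈ ball (0 : ℂ) 1, 1 - w ≠ 0 := by
    intro w hw h
    have : w = 1 := by linear_combination -h
    simp [this] at hw
  have hmaps : ∀ w ∈ ball (0 : ℂ) 1, I * (1 + w) / (1 - w) ∈ UHP := by
    intro w hw
    have h1 : ‖w‖ ^ 2 < 1 := by
      have : ‖w‖ < 1 := by simpa using hw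
      have := norm_nonneg w
      nlinarith
    have h0 := hne w hw
    have hpos : 0 < Complex.normSq (1 - w) := Complex.normSq_pos.2 h0
    rw [Complex.sq_norm, Complex.normSq_apply] at h1
    simp only [UHP, mem_ofPred_eq, Complex.div_im]
    simp
    rw [← sub_pos]
    have : (1 + w.re) * (1 - w.re) / normSq (1 - w) - -(w.im * w.im) / normSq (1 - w)
      = (1 - w.re * w.re - w.im * -w.im) / normSq (1 - w) := by ring
    first
    | (have h2 : 0 < (1 - (w.re * w.re + w.im * w.im)) / normSq (1 - w) := by
         apply div_pos _ hpos; linarith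
       convert h2 using 1; ring)
  have hd : DifferentiableOn ℂ (fun w => f (I * (1 + w) / (1 - w)) * (2 * I / (1 - w) ^ 2))
      (ball 0 1) := by
    apply DifferentiableOn.mul
    · apply hf.comp (t := UHP) _ hmaps
      apply DifferentiableOn.div <;> [fun_prop; fun_prop; exact hne]
    · apply DifferentiableOn.div <;> [fun_prop; fun_prop; exact fun w hw => pow_ne_zero _ (hne w hw)]
  obtain ⟨W, hW⟩ := hd.isExactOn_ball
  refine ⟨fun z => W ((z - I) / (z + I)), fun z hz => ?_⟩
  have hz' : 0 < z.im := hz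
  have hzI : z + I ≠ 0 := by
    intro h
    have := congrArg Complex.im h
    simp at this
    linarith
  have hw : (z - I) / (z + I) ∈ ball (0 : ℂ) 1 := by
    simp only [mem_ball_zero_iff, norm_div]
    rw [div_lt_one (norm_pos_iff.2 hzI)]
    apply lt_of_pow_lt_pow_left₀ 2 (norm_nonneg _)
    rw [Complex.sq_norm, Complex.sq_norm, Complex.normSq_apply, Complex.normSq_apply]
    simp
    nlinarith
  have h1 := hW _ hw
  have h2 : HasDerivAt (fun z : ℂ => (z - I) / (z + I))
      ((1 * (z + I) - (z - I) * 1) / (z + I) ^ 2) z :=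
    ((hasDerivAt_id z).sub_const I).div ((hasDerivAt_id z).add_const I) hzI
  have h3 := h1.comp z h2
  refine HasDerivAt.congr_deriv (f := fun z => W ((z - I) / (z + I))) h3 ?_
  have e1 : 1 - (z - I) / (z + I) = 2 * I / (z + I) := by field_simp; ring
  have e2 : I * (1 + (z - I) / (z + I)) / (1 - (z - I) / (z + I)) = z := by
    rw [e1]; field_simp; ring
  simp only [e1]
  field_simp
  ring_nf

/-- Two primitives on a piece of the upper half-plane differ by a constant. -/
lemma eq_add_const (V W f : ℂ → ℂ) (s : Set ℂ) (hs : Convex ℝ s) (hso : IsOpen s)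
    (hV : ∀ z ∈ s, HasDerivAt V (f z) z) (hW : ∀ z ∈ s, HasDerivAt W (f z) z) :
    ∃ c, ∀ z ∈ s, V z = W z + c := by
  rcases s.eq_empty_or_nonempty with rfl | ⟨z0, hz0⟩
  · exact ⟨0, by simp⟩
  refine ⟨V z0 - W z0, fun z hz => ?_⟩
  have hd : ∀ z ∈ s, HasDerivAt (fun z => V z - W z) 0 z := fun z hz =>
    ((hV z hz).sub (hW z hz)).congr_deriv (sub_self _)
  have := hso.is_const_of_deriv_eq_zero hs.isPreconnected
    (fun z hz => (hd z hz).differentiableAt.differentiableWithinAt)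
    (fun z hz => (hd z hz).deriv) hz hz0
  linear_combination this

/-! ### The square root branch -/

/-- Square root, cut along the negative imaginary axis. -/
def EE (w : ℂ) : ℂ := Complex.exp (I * Real.pi / 4) * Complex.exp (1 / 2 * Complex.log (-I * w))

lemma EE_ne (w : ℂ) : EE w ≠ 0 := mul_ne_zero (Complex.exp_ne_zero _) (Complex.exp_ne_zero _)

lemma EE_sq (w : ℂ) (hw : w ≠ 0) : EE w ^ 2 = w := by
  unfold EE
  rw [mul_pow, ← Complex.exp_nat_mul, ← Complex.exp_nat_mul]
  have h1 : ((2 : ℕ) : ℂ) * (I * Real.pi / 4) = Real.pi / 2 * I := by push_cast; ring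
  have h2 : ((2 : ℕ) : ℂ) * (1 / 2 * Complex.log (-I * w)) = Complex.log (-I * w) := by
    push_cast; ring
  rw [h1, h2, Complex.exp_pi_div_two_mul_I, Complex.exp_log (by simp [hw])]
  linear_combination -w * I_sq

lemma log_eq (w : ℂ) (hw : w ≠ 0) (him : 0 ≤ w.im) :
    Complex.log w = Real.pi / 2 * I + Complex.log (-I * w) := by
  have h1 : |Complex.arg (-I * w)| ≤ Real.pi / 2 := by
    rw [Complex.abs_arg_le_pi_div_two_iff]; simpa using him
  have h2 : w = I * (-I * w) := by linear_combination w * I_sq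
  conv_lhs => rw [h2]
  rw [Complex.log_mul (by simp) (by simp [hw]), Complex.log_I]
  rw [Complex.arg_I]
  have := abs_le.1 h1
  have := Real.pi_pos
  constructor <;> linarith

lemma EE_eq (w : ℂ) (hw : w ≠ 0) (him : 0 ≤ w.im) :
    Complex.exp ((1 / 2 : ℂ) * Complex.log w) = EE w := by
  unfold EE
  rw [log_eq w hw him, ← Complex.exp_add]
  ring_nf

lemma EE_pos (t : ℝ) (ht : 0 < t) : EE (t : ℂ) = (√t : ℝ) := by
  rw [← EE_eq _ (by simpa using ht.ne') (by simp), ← Complex.ofReal_log ht.le,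
    Real.sqrt_eq_rpow, Real.rpow_def_of_pos ht]
  push_cast
  ring_nf

lemma EE_neg (t : ℝ) (ht : t < 0) : EE (t : ℂ) = I * (√(-t) : ℝ) := by
  have ht' : 0 < -t := by linarith
  have h1 : -I * (t : ℂ) = I * ((-t : ℝ) : ℂ) := by push_cast; ring
  have h2 : Complex.log (-I * (t : ℂ)) = Real.pi / 2 * I + (Real.log (-t) : ℝ) := by
    rw [h1, mul_comm, Complex.log_ofReal_mul ht' (by simp), Complex.log_I]; ring
  unfold EE
  rw [h2, Real.sqrt_eq_rpow, Real.rpow_def_of_pos ht', ← Complex.exp_add]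
  push_cast
  conv_rhs => rw [← Complex.exp_pi_div_two_mul_I]
  rw [← Complex.exp_add]
  ring_nf

lemma slit_of (w : ℂ) (h : 0 < w.im ∨ w.re ≠ 0) : -I * w ∈ Complex.slitPlane := by
  rw [Complex.mem_slitPlane_iff]
  simpa using h

lemma EE_hasDerivAt (w : ℂ) (h : 0 < w.im ∨ w.re ≠ 0) : HasDerivAt EE (1 / (2 * EE w)) w := by
  have hw : w ≠ 0 := by
    rintro rfl
    simp at h
  have h1 : HasDerivAt (fun w : ℂ => -I * w) (-I) w := by
    simpa using (hasDerivAt_id w).const_mul (-I)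
  have h2 := ((h1.clog (slit_of w h)).const_mul (1 / 2 : ℂ)).cexp.const_mul
    (Complex.exp (I * Real.pi / 4))
  have h3 : HasDerivAt EE (EE w * (1 / 2 * (-I / (-I * w)))) w := by
    refine HasDerivAt.congr_deriv (f := EE) h2 ?_
    unfold EE; ring
  refine h3.congr_deriv ?_
  have e := EE_sq w hw
  have e0 := EE_ne w
  have : -I / (-I * w) = 1 / w := by field_simp
  rw [this]
  field_simp
  linear_combination e

lemma norm_EE_sq (w : ℂ) (hw : w ≠ 0) : ‖EE w‖ ^ 2 = ‖w‖ := by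
  rw [← norm_pow, EE_sq w hw]

/-- Product of the shifted square roots. -/
def PP (S : Finset ℕ) (y : ℕ → ℝ) (u : ℂ) : ℂ := ∏ j ∈ S, EE (u - (y j : ℂ))

lemma PP_ne (S : Finset ℕ) (y : ℕ → ℝ) (u : ℂ) : PP S y u ≠ 0 :=
  Finset.prod_ne_zero_iff.2 fun _ _ => EE_ne _

lemma good_eventually (S : Finset ℕ) (y : ℕ → ℝ) (u : ℂ) (hu : u ∈ cUHP)
    (h : ∀ j ∈ S, u ≠ (y j : ℂ)) :
    ∀ᶠ w in 𝓝 u, ∀ j ∈ S, (0 < (w - (y j : ℂ)).im ∨ (w - (y j : ℂ)).re ≠ 0) := by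
  rw [Finset.eventually_all]
  intro j hj
  have ho : IsOpen {w : ℂ | 0 < (w - (y j : ℂ)).im ∨ (w - (y j : ℂ)).re ≠ 0} := by
    apply IsOpen.union
    · exact isOpen_lt continuous_const
        (Complex.continuous_im.comp (continuous_id.sub continuous_const))
    · exact isOpen_ne_fun
        (Complex.continuous_re.comp (continuous_id.sub continuous_const)) continuous_const
  apply ho.mem_nhds
  change 0 < (u - (y j : ℂ)).im ∨ (u - (y j : ℂ)).re ≠ 0
  by_contra hc
  push Not at hc
  apply h j hj
  have hu' : 0 ≤ u.im := hu
  apply Complex.ext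
  · have := hc.2
    simp at this ⊢
    linarith
  · have := hc.1
    simp at this ⊢
    linarith

lemma PP_diff (S : Finset ℕ) (y : ℕ → ℝ) (u : ℂ)
    (h : ∀ j ∈ S, (0 < (u - (y j : ℂ)).im ∨ (u - (y j : ℂ)).re ≠ 0)) :
    DifferentiableAt ℂ (PP S y) u := by
  unfold PP
  apply DifferentiableAt.fun_finsetProd
  intro j hj
  exact DifferentiableAt.comp (g := EE) (f := fun u : ℂ => u - (y j : ℂ)) u
    (EE_hasDerivAt _ (h j hj)).differentiableAt (differentiableAt_id.sub_const _)

lemma quot_eventually_diff (S : Finset ℕ) (y : ℕ → ℝ) (x : ℝ) (H : ℂ → ℂ)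
    (hH : DifferentiableOn ℂ H {(x : ℂ)}ᶜ) (u : ℂ) (hu : u ∈ cUHP) (hux : u ≠ x)
    (h : ∀ j ∈ S, u ≠ (y j : ℂ)) :
    ∀ᶠ w in 𝓝 u, DifferentiableAt ℂ (fun w => H w / PP S y w) w := by
  filter_upwards [good_eventually S y u hu h, isOpen_compl_singleton.mem_nhds hux] with w h1 h2
  exact (hH.differentiableAt (isOpen_compl_singleton.mem_nhds h2)).div (PP_diff S y w h1)
    (PP_ne S y w)

lemma ofReal_mem_cUHP (p : ℝ) : (p : ℂ) ∈ cUHP := by simp [cUHP]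

lemma UHP_ne_real (z : ℂ) (hz : z ∈ UHP) (p : ℝ) : z ≠ p := by
  rintro rfl
  simp [UHP] at hz

lemma EE_tendsto_zero (y : ℝ) :
    Tendsto (fun u : ℂ => EE (u - y)) (𝓝[UHP] (y : ℂ)) (𝓝 0) := by
  rw [tendsto_zero_iff_norm_tendsto_zero]
  have h : Tendsto (fun u : ℂ => √‖u - y‖) (𝓝[UHP] (y : ℂ)) (𝓝 0) := by
    have : Continuous (fun u : ℂ => √‖u - y‖) := by fun_prop
    have := this.tendsto (y : ℂ)
    simp only [sub_self, norm_zero, Real.sqrt_zero] at this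
    exact this.mono_left nhdsWithin_le_nhds
  refine h.congr' ?_
  filter_upwards [self_mem_nhdsWithin] with u hu
  rw [← norm_EE_sq _ (sub_ne_zero.2 (UHP_ne_real u hu y)), Real.sqrt_sq (norm_nonneg _)]

lemma main_primitive (S : Finset ℕ) (y : ℕ → ℝ) (hy : ∀ i ∈ S, ∀ j ∈ S, i ≠ j → y i ≠ y j)
    (x : ℝ) (hxy : ∀ i ∈ S, y i ≠ x) (H : ℂ → ℂ) (hH : DifferentiableOn ℂ H {(x : ℂ)}ᶜ) :
    ∃ V : ℂ → ℂ, (∀ z ∈ UHP, HasDerivAt V (H z / PP S y z) z) ∧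
      ContinuousOn V (cUHP \ {(x : ℂ)}) ∧
      ∀ p : ℝ, p ≠ x → (∀ j ∈ S, p ≠ y j) →
        HasDerivAt (fun t : ℝ => V t) (H p / PP S y p) p := by
  obtain ⟨V0, hV0⟩ := primitive_UHP (fun w => H w / PP S y w) (by
    intro z hz
    exact (quot_eventually_diff S y x H hH z (le_of_lt (show 0 < z.im from hz))
      (UHP_ne_real z hz x)
      (fun j _ => UHP_ne_real z hz (y j))).self_of_nhds.differentiableWithinAt)
  -- regular points
  have hreg : ∀ p ∈ cUHP, p ≠ (x : ℂ) → (∀ j ∈ S, p ≠ (y j : ℂ)) →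
      ∃ r > 0, ∃ W : ℂ → ℂ, (∀ z ∈ ball p r, HasDerivAt W (H z / PP S y z) z) ∧
        ∀ z ∈ ball p r ∩ UHP, V0 z = W z := by
    intro p hp hpx hpy
    obtain ⟨r, hr, hball⟩ := Metric.eventually_nhds_iff_ball.1
      (quot_eventually_diff S y x H hH p hp hpx hpy)
    have hd : DifferentiableOn ℂ (fun w => H w / PP S y w) (ball p r) :=
      fun z hz => (hball z hz).differentiableWithinAt
    obtain ⟨W, hW⟩ := hd.isExactOn_ball
    obtain ⟨c, hc⟩ := eq_add_const V0 W (fun w => H w / PP S y w) (ball p r ∩ UHP)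
      ((convex_ball p r).inter UHP_convex) (isOpen_ball.inter UHP_isOpen)
      (fun z hz => hV0 z hz.2) (fun z hz => hW z hz.1)
    refine ⟨r, hr, fun z => W z + c, fun z hz => (hW z hz).add_const c, hc⟩
  have hlim : ∀ (p : ℂ) (r : ℝ) (W : ℂ → ℂ) , (∀ z ∈ ball p r, HasDerivAt W (H z / PP S y z) z) →
        (∀ z ∈ ball p r ∩ UHP, V0 z = W z) → ∀ q ∈ ball p r,
        Tendsto V0 (𝓝[UHP] q) (𝓝 (W q)) := by
    intro p r W hW hVW q hq
    have h1 : Tendsto W (𝓝[UHP] q) (𝓝 (W q)) :=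
      (hW q hq).continuousAt.tendsto.mono_left nhdsWithin_le_nhds
    refine h1.congr' ?_
    filter_upwards [self_mem_nhdsWithin, nhdsWithin_le_nhds (isOpen_ball.mem_nhds hq)] with z h1 h2
    exact (hVW z ⟨h2, h1⟩).symm
  -- singular points
  have hsing : ∀ k ∈ S, ∃ l, Tendsto V0 (𝓝[UHP] (y k : ℂ)) (𝓝 l) := by
    intro k hk
    obtain ⟨r, hr, hball⟩ := Metric.eventually_nhds_iff_ball.1
      (quot_eventually_diff (S.erase k) y x H hH (y k) (ofReal_mem_cUHP _)
        (by exact_mod_cast hxy k hk)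
        (by
          intro j hj
          have := hy k hk j (Finset.mem_of_mem_erase hj) (Finset.ne_of_mem_erase hj).symm
          exact_mod_cast this))
    set h : ℂ → ℂ := fun w => H w / PP (S.erase k) y w with hh
    have hsq : ∀ s ∈ ball (0 : ℂ) (√r), (y k : ℂ) + s ^ 2 ∈ ball (y k : ℂ) r := by
      intro s hs
      have : ‖s‖ < √r := by simpa using hs
      have h2 : ‖s‖ ^ 2 < r := (Real.lt_sqrt (norm_nonneg s)).1 this
      simpa using h2
    have hd : DifferentiableOn ℂ (fun s : ℂ => 2 * h (y k + s ^ 2)) (ball 0 (√r)) := by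
      intro s hs
      apply DifferentiableAt.differentiableWithinAt
      apply DifferentiableAt.const_mul
      exact DifferentiableAt.comp (g := h) s (hball _ (hsq s hs)) (by fun_prop)
    obtain ⟨W, hW⟩ := hd.isExactOn_ball
    have hE : ∀ z ∈ ball (y k : ℂ) r ∩ UHP, EE (z - y k) ∈ ball (0 : ℂ) (√r) := by
      intro z hz
      have h1 := norm_EE_sq _ (sub_ne_zero.2 (UHP_ne_real z hz.2 (y k)))
      have h2 : ‖z - y k‖ < r := by simpa [dist_eq_norm] using hz.1
      simp only [mem_ball_zero_iff]
      rw [Real.lt_sqrt (norm_nonneg _), h1]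
      exact h2
    obtain ⟨c, hc⟩ := eq_add_const V0 (fun z => W (EE (z - y k))) (fun w => H w / PP S y w)
      (ball (y k : ℂ) r ∩ UHP)
      ((convex_ball _ r).inter UHP_convex) (isOpen_ball.inter UHP_isOpen)
      (fun z hz => hV0 z hz.2) (fun z hz => by
        have h1 := hW _ (hE z hz)
        have hzim : 0 < z.im := hz.2
        have h2 : HasDerivAt (fun z : ℂ => EE (z - y k)) (1 / (2 * EE (z - y k)) * 1) z :=
          HasDerivAt.comp (h₂ := EE) (h := fun z : ℂ => z - (y k : ℂ)) z
            (EE_hasDerivAt (z - y k) (Or.inl (by simpa using hzim)))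
            ((hasDerivAt_id z).sub_const (y k : ℂ))
        refine HasDerivAt.congr_deriv (f := fun z => W (EE (z - y k))) (h1.comp z h2) ?_
        have e := EE_sq _ (sub_ne_zero.2 (UHP_ne_real z hz.2 (y k)))
        have e0 := EE_ne (z - y k)
        have e1 : PP S y z = EE (z - y k) * PP (S.erase k) y z := by
          unfold PP
          rw [Finset.mul_prod_erase S (fun j => EE (z - y j)) hk]
        have e2 := PP_ne (S.erase k) y z
        simp only [hh]
        rw [e, e1]
        simp only [add_sub_cancel]
        field_simp)
    refine ⟨W 0 + c, ?_⟩
    have h0 : (0 : ℂ) ∈ ball (0 : ℂ) (√r) := by simpa using hr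
    have h1 : Tendsto (fun z : ℂ => W (EE (z - y k)) + c) (𝓝[UHP] (y k : ℂ)) (𝓝 (W 0 + c)) :=
      ((hW 0 h0).continuousAt.tendsto.comp (EE_tendsto_zero (y k))).add_const c
    refine h1.congr' ?_
    filter_upwards [self_mem_nhdsWithin,
      nhdsWithin_le_nhds (isOpen_ball.mem_nhds (mem_ball_self hr))] with z h1 h2
    exact (hc z ⟨h2, h1⟩).symm
  have hc0 : ContinuousOn V0 UHP := fun z hz => (hV0 z hz).continuousAt.continuousWithinAt
  refine ⟨extendFrom UHP V0, ?_, ?_, ?_⟩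
  · intro z hz
    apply (hV0 z hz).congr_of_eventuallyEq
    filter_upwards [UHP_isOpen.mem_nhds hz] with w hw
    exact extendFrom_extends hc0 w hw
  · apply continuousOn_extendFrom (fun z hz => cUHP_subset_closure hz.1)
    intro p hp
    by_cases hpy : ∀ j ∈ S, p ≠ (y j : ℂ)
    · obtain ⟨r, hr, W, h1, h2⟩ := hreg p hp.1 hp.2 hpy
      exact ⟨_, hlim p r W h1 h2 p (mem_ball_self hr)⟩
    · push Not at hpy
      obtain ⟨k, hk, rfl⟩ := hpy
      exact hsing k hk
  · intro p hpx hpy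
    obtain ⟨r, hr, W, h1, h2⟩ := hreg p (ofReal_mem_cUHP p) (by exact_mod_cast hpx)
      (by intro j hj; exact_mod_cast hpy j hj)
    have h3 := (h1 p (mem_ball_self hr)).comp_ofReal
    apply h3.congr_of_eventuallyEq
    have : ∀ᶠ t : ℝ in 𝓝 p, (t : ℂ) ∈ ball (p : ℂ) r :=
      Complex.continuous_ofReal.continuousAt.eventually (isOpen_ball.mem_nhds (mem_ball_self hr))
    filter_upwards [this] with t ht
    exact extendFrom_eq (cUHP_subset_closure (ofReal_mem_cUHP t)) (hlim p r W h1 h2 t ht)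

/-! ### Values on the real line -/

lemma sqrtProd_eq (N : ℕ) (y : ℕ → ℝ) (u : ℂ) (hu : u ∈ cUHP)
    (h : ∀ j ∈ Finset.Icc 1 (2 * N), u ≠ (y j : ℂ)) :
    sqrtProd N y u = PP (Finset.Icc 1 (2 * N)) y u := by
  unfold sqrtProd PP
  apply Finset.prod_congr rfl
  intro j hj
  apply EE_eq _ (sub_ne_zero.2 (h j hj))
  have hu' : 0 ≤ u.im := hu
  simpa using hu'

/-- Modulus of the product on the real line. -/
def RR (N : ℕ) (y : ℕ → ℝ) (p : ℝ) : ℝ := ∏ j ∈ Finset.Icc 1 (2 * N), √|p - y j|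

/-- `p` lies strictly between `y k` and `y (k+1)`. -/
def Gap (N : ℕ) (y : ℕ → ℝ) (k : ℕ) (p : ℝ) : Prop :=
  (∀ j ∈ Finset.Icc 1 (2 * N), j ≤ k → y j < p) ∧ (∀ j ∈ Finset.Icc 1 (2 * N), k < j → p < y j)

lemma Gap.ne {N : ℕ} {y : ℕ → ℝ} {k : ℕ} {p : ℝ} (h : Gap N y k p) :
    ∀ j ∈ Finset.Icc 1 (2 * N), p ≠ y j := by
  intro j hj
  rcases le_or_gt j k with hk | hk
  · exact (h.1 j hj hk).ne'
  · exact (h.2 j hj hk).ne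

lemma gap_Ioo {N : ℕ} {y : ℕ → ℝ}
    (hy : ∀ i j : ℕ, 1 ≤ i → i < j → j ≤ 2 * N → y i < y j) {k : ℕ} (h1 : 1 ≤ k)
    (h2 : k + 1 ≤ 2 * N) {p : ℝ} (hp : p ∈ Ioo (y k) (y (k + 1))) : Gap N y k p := by
  constructor
  · intro j hj hjk
    rw [Finset.mem_Icc] at hj
    rcases hjk.eq_or_lt with rfl | hlt
    · exact hp.1
    · exact (hy j k hj.1 hlt (by omega)).trans hp.1
  · intro j hj hjk
    rw [Finset.mem_Icc] at hj
    rcases (Nat.succ_le_of_lt hjk).eq_or_lt with rfl | hlt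
    · exact hp.2
    · exact hp.2.trans (hy (k + 1) j (by omega) hlt hj.2)

lemma gap_left {N : ℕ} {y : ℕ → ℝ}
    (hy : ∀ i j : ℕ, 1 ≤ i → i < j → j ≤ 2 * N → y i < y j) {p : ℝ} (hp : p < y 1) :
    Gap N y 0 p := by
  constructor
  · intro j hj hjk
    rw [Finset.mem_Icc] at hj
    omega
  · intro j hj hjk
    rw [Finset.mem_Icc] at hj
    rcases hj.1.eq_or_lt with rfl | hlt
    · exact hp
    · exact hp.trans (hy 1 j (by omega) hlt hj.2)

lemma gap_right {N : ℕ} {y : ℕ → ℝ}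
    (hy : ∀ i j : ℕ, 1 ≤ i → i < j → j ≤ 2 * N → y i < y j) {p : ℝ} (hp : y (2 * N) < p) :
    Gap N y (2 * N) p := by
  constructor
  · intro j hj hjk
    rw [Finset.mem_Icc] at hj
    rcases hj.2.eq_or_lt with rfl | hlt
    · exact hp
    · exact (hy j (2 * N) (by omega) hlt le_rfl).trans hp
  · intro j hj hjk
    rw [Finset.mem_Icc] at hj
    omega

lemma RR_pos {N : ℕ} {y : ℕ → ℝ} {p : ℝ} (h : ∀ j ∈ Finset.Icc 1 (2 * N), p ≠ y j) :
    0 < RR N y p :=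
  Finset.prod_pos fun j hj => Real.sqrt_pos.2 (abs_pos.2 (sub_ne_zero.2 (h j hj)))

lemma PP_real {N : ℕ} {y : ℕ → ℝ} {k : ℕ} {p : ℝ} (h : Gap N y k p) :
    PP (Finset.Icc 1 (2 * N)) y p = I ^ (2 * N - k) * (RR N y p : ℂ) := by
  have h1 : ∀ j ∈ Finset.Icc 1 (2 * N), EE ((p : ℂ) - (y j : ℂ)) =
      (if k < j then I else 1) * ((√|p - y j| : ℝ) : ℂ) := by
    intro j hj
    rw [← Complex.ofReal_sub]
    split_ifs with hk
    · have := h.2 j hj hk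
      rw [EE_neg _ (by linarith), abs_of_neg (by linarith)]
    · have := h.1 j hj (not_lt.1 hk)
      rw [EE_pos _ (by linarith), abs_of_pos (by linarith), one_mul]
  unfold PP RR
  rw [Finset.prod_congr rfl h1, Finset.prod_mul_distrib, Finset.prod_ite]
  simp only [Finset.prod_const, one_pow, mul_one]
  rw [← Complex.ofReal_prod]
  congr 2
  have : (Finset.Icc 1 (2 * N)).filter (fun j => k < j) = Finset.Ioc k (2 * N) := by
    ext j
    simp only [Finset.mem_filter, Finset.mem_Icc, Finset.mem_Ioc]
    omega
  rw [this, Nat.card_Ioc]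

lemma hasDerivAt_re {f : ℝ → ℂ} {f' : ℂ} {p : ℝ} (h : HasDerivAt f f' p) :
    HasDerivAt (fun t => (f t).re) f'.re p :=
  Complex.reCLM.hasFDerivAt.comp_hasDerivAt p h

lemma hasDerivAt_im {f : ℝ → ℂ} {f' : ℂ} {p : ℝ} (h : HasDerivAt f f' p) :
    HasDerivAt (fun t => (f t).im) f'.im p :=
  Complex.imCLM.hasFDerivAt.comp_hasDerivAt p h

lemma const_of_deriv (f : ℝ → ℝ) (a b : ℝ) (hab : a ≤ b) (hc : ContinuousOn f (Icc a b))
    (hd : ∀ p ∈ Ioo a b, HasDerivAt f 0 p) : f b = f a := by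
  rcases hab.eq_or_lt with rfl | hab
  · rfl
  obtain ⟨c, -, h⟩ := exists_hasDerivAt_eq_slope f (fun _ => 0) hab hc hd
  have : b - a ≠ 0 := by linarith
  field_simp at h
  linarith

lemma cont_real {V : ℂ → ℂ} {x : ℝ} (hV : ContinuousOn V (cUHP \ {(x : ℂ)})) (s : Set ℝ)
    (hs : x ∉ s) : ContinuousOn (fun t : ℝ => V t) s := by
  apply hV.comp Complex.continuous_ofReal.continuousOn
  intro t ht
  refine ⟨ofReal_mem_cUHP t, ?_⟩
  simp only [mem_singleton_iff, Complex.ofReal_inj]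
  rintro rfl
  exact hs ht

lemma y_inj {N : ℕ} {y : ℕ → ℝ} (hy : ∀ i j : ℕ, 1 ≤ i → i < j → j ≤ 2 * N → y i < y j) :
    ∀ i ∈ Finset.Icc 1 (2 * N), ∀ j ∈ Finset.Icc 1 (2 * N), i ≠ j → y i ≠ y j := by
  intro i hi j hj hij
  rw [Finset.mem_Icc] at hi hj
  rcases lt_or_gt_of_ne hij with h | h
  · exact (hy i j hi.1 h hj.2).ne
  · exact (hy j i hj.1 h hi.2).ne'

lemma integrable_gap {N : ℕ} {y : ℕ → ℝ}
    (hy : ∀ i j : ℕ, 1 ≤ i → i < j → j ≤ 2 * N → y i < y j) {k : ℕ} (h1 : 1 ≤ k)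
    (h2 : k + 1 ≤ 2 * N) (x : ℝ) (hxy : ∀ i ∈ Finset.Icc 1 (2 * N), y i ≠ x)
    (hx : x ∉ Icc (y k) (y (k + 1))) :
    IntervalIntegrable (fun p => 1 / RR N y p) volume (y k) (y (k + 1)) := by
  obtain ⟨V, -, hV2, hV3⟩ := main_primitive (Finset.Icc 1 (2 * N)) y (y_inj hy) x hxy
    (fun _ => I ^ (2 * N - k)) (by fun_prop)
  have hlt := hy k (k + 1) h1 (by omega) h2
  apply intervalIntegrable_deriv_of_nonneg (g := fun t : ℝ => (V t).re)
  · rw [uIcc_of_le hlt.le]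
    exact Complex.continuous_re.comp_continuousOn (cont_real hV2 _ hx)
  · rw [min_eq_left hlt.le, max_eq_right hlt.le]
    intro p hp
    have hg := gap_Ioo hy h1 h2 hp
    have := hasDerivAt_re (hV3 p (by rintro rfl; exact hx (Ioo_subset_Icc_self hp)) hg.ne)
    refine this.congr_deriv ?_
    have hI : (I : ℂ) ^ (2 * N - k) ≠ 0 := pow_ne_zero _ I_ne_zero
    rw [PP_real hg]
    have : I ^ (2 * N - k) / (I ^ (2 * N - k) * (RR N y p : ℂ)) = ((1 / RR N y p : ℝ) : ℂ) := by
      push_cast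
      field_simp
    rw [this, Complex.ofReal_re]
  · rw [min_eq_left hlt.le, max_eq_right hlt.le]
    intro p hp
    exact (one_div_pos.2 (RR_pos (gap_Ioo hy h1 h2 hp).ne)).le

lemma ftc_gap {N : ℕ} {y : ℕ → ℝ}
    (hy : ∀ i j : ℕ, 1 ≤ i → i < j → j ≤ 2 * N → y i < y j) {k : ℕ} (h1 : 1 ≤ k)
    (h2 : k + 1 ≤ 2 * N) (x : ℝ) (hxy : ∀ i ∈ Finset.Icc 1 (2 * N), y i ≠ x)
    (hx : x ∉ Icc (y k) (y (k + 1))) (H V : ℂ → ℂ) (hH : ContinuousOn H {(x : ℂ)}ᶜ)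
    (hV2 : ContinuousOn V (cUHP \ {(x : ℂ)}))
    (hV3 : ∀ p : ℝ, p ≠ x → (∀ j ∈ Finset.Icc 1 (2 * N), p ≠ y j) →
        HasDerivAt (fun t : ℝ => V t) (H p / PP (Finset.Icc 1 (2 * N)) y p) p) :
    ∫ u in (y k)..(y (k + 1)), H u / sqrtProd N y u = V (y (k + 1)) - V (y k) := by
  have hlt := hy k (k + 1) h1 (by omega) h2
  have hI : (I : ℂ) ^ (2 * N - k) ≠ 0 := pow_ne_zero _ I_ne_zero
  have hintg : IntervalIntegrable
      (fun p : ℝ => ((1 / RR N y p : ℝ) : ℂ) * (H p / I ^ (2 * N - k)))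
      volume (y k) (y (k + 1)) := by
    apply IntervalIntegrable.mul_continuousOn
    · have hi := integrable_gap hy h1 h2 x hxy hx
      exact ⟨Integrable.ofReal hi.1, Integrable.ofReal hi.2⟩
    · apply ContinuousOn.div_const
      apply hH.comp Complex.continuous_ofReal.continuousOn
      rw [uIcc_of_le hlt.le]
      intro t ht
      simp only [mem_compl_iff, mem_singleton_iff, Complex.ofReal_inj]
      rintro rfl
      exact hx ht
  have heq : ∀ p ∈ Ioo (y k) (y (k + 1)), H p / PP (Finset.Icc 1 (2 * N)) y p =
      ((1 / RR N y p : ℝ) : ℂ) * (H p / I ^ (2 * N - k)) := by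
    intro p hp
    rw [PP_real (gap_Ioo hy h1 h2 hp)]
    push_cast
    ring
  rw [integral_congr_Ioo_of_le hlt.le
    (g := fun p : ℝ => ((1 / RR N y p : ℝ) : ℂ) * (H p / I ^ (2 * N - k)))]
  · apply integral_eq_sub_of_hasDerivAt_of_le (f := fun t : ℝ => V t) hlt.le
      (cont_real hV2 _ hx) _ hintg
    intro p hp
    rw [← heq p hp]
    exact hV3 p (by rintro rfl; exact hx (Ioo_subset_Icc_self hp)) (gap_Ioo hy h1 h2 hp).ne
  · intro p hp
    simp only
    rw [← heq p hp, sqrtProd_eq N y p (ofReal_mem_cUHP p)]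
    intro j hj
    exact_mod_cast (gap_Ioo hy h1 h2 hp).ne j hj

lemma aeval_real (Q : Polynomial ℝ) (p : ℝ) :
    Polynomial.aeval (p : ℂ) Q = ((Q.eval p : ℝ) : ℂ) := Polynomial.aeval_ofReal (K := ℂ) Q p

lemma root_gap {N : ℕ} {y : ℕ → ℝ}
    (hy : ∀ i j : ℕ, 1 ≤ i → i < j → j ≤ 2 * N → y i < y j) {k : ℕ} (h1 : 1 ≤ k)
    (h2 : k + 1 ≤ 2 * N) (x : ℝ) 
    (hx : x ∉ Icc (y k) (y (k + 1))) (Q : Polynomial ℝ) (V : ℂ → ℂ)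
    (hV2 : ContinuousOn V (cUHP \ {(x : ℂ)}))
    (hV3 : ∀ p : ℝ, p ≠ x → (∀ j ∈ Finset.Icc 1 (2 * N), p ≠ y j) →
        HasDerivAt (fun t : ℝ => V t)
          ((Polynomial.aeval (p : ℂ) Q / ((p : ℂ) - x) ^ 2) / PP (Finset.Icc 1 (2 * N)) y p) p)
    (heq : V (y (k + 1)) = V (y k)) : ∃ p ∈ Ioo (y k) (y (k + 1)), Q.eval p = 0 := by
  have hlt := hy k (k + 1) h1 (by omega) h2
  have hI : (I : ℂ) ^ (2 * N - k) ≠ 0 := pow_ne_zero _ I_ne_zero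
  obtain ⟨c, hc, hc'⟩ := exists_hasDerivAt_eq_zero
    (f := fun t : ℝ => (I ^ (2 * N - k) * V t).re)
    (f' := fun t : ℝ => Q.eval t / ((t - x) ^ 2 * RR N y t)) hlt
    (Complex.continuous_re.comp_continuousOn ((cont_real hV2 _ hx).const_mul _))
    (by simp only [heq])
    (by
      intro p hp
      have hg := gap_Ioo hy h1 h2 hp
      have := hasDerivAt_re
        ((hV3 p (by rintro rfl; exact hx (Ioo_subset_Icc_self hp)) hg.ne).const_mul
          (I ^ (2 * N - k)))
      refine this.congr_deriv ?_
      rw [PP_real hg, aeval_real]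
      have : I ^ (2 * N - k) * ((Q.eval p : ℝ) / ((p : ℂ) - x) ^ 2 /
          (I ^ (2 * N - k) * (RR N y p : ℂ))) =
          ((Q.eval p / ((p - x) ^ 2 * RR N y p) : ℝ) : ℂ) := by
        push_cast
        field_simp
      rw [this, Complex.ofReal_re])
  refine ⟨c, hc, ?_⟩
  have hr := RR_pos (gap_Ioo hy h1 h2 hc).ne
  have hcx : (c - x) ^ 2 ≠ 0 := by
    apply pow_ne_zero
    rw [sub_ne_zero]
    rintro rfl
    exact hx (Ioo_subset_Icc_self hc)
  rcases div_eq_zero_iff.1 hc' with h | h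
  · exact h
  · exact absurd h (mul_ne_zero hcx hr.ne')

/-- All zeros of `Q` lie in the gaps, so `Q x ≠ 0`. -/
lemma Q_ne_zero {N : ℕ} (hN : 3 ≤ N) {y : ℕ → ℝ}
    (hy : ∀ i j : ℕ, 1 ≤ i → i < j → j ≤ 2 * N → y i < y j) (x : ℝ)
    (hx : y (2 * N - 1) < x) (Q : Polynomial ℝ) (hQ0 : Q ≠ 0) (hQ : Q.natDegree = N - 2)
    (h : ∀ i : Fin (N - 2), ∃ p ∈ Ioo (y (2 * (i : ℕ) + 3)) (y (2 * (i : ℕ) + 4)), Q.eval p = 0) :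
    Q.eval x ≠ 0 := by
  intro hQx
  choose r hr hr0 using h
  have hmono : StrictMono r := by
    intro i j hij
    have hij' : (i : ℕ) < j := hij
    have hj := j.2
    have h3 : y (2 * (i : ℕ) + 4) < y (2 * (j : ℕ) + 3) :=
      hy _ _ (by omega) (by omega) (by omega)
    exact (hr i).2.trans (h3.trans (hr j).1)
  have hrx : ∀ i, r i < x := by
    intro i
    have hi := i.2
    refine (hr i).2.trans (lt_trans ?_ hx)
    exact hy _ _ (by omega) (by omega) (by omega)
  have hcard := Polynomial.card_le_degree_of_subset_roots (p := Q)
    (Z := insert x (Finset.univ.image r)) (by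
      intro t ht
      rw [Finset.mem_val, Finset.mem_insert, Finset.mem_image] at ht
      rw [Polynomial.mem_roots hQ0]
      rcases ht with rfl | ⟨i, -, rfl⟩
      · exact hQx
      · exact hr0 i)
  rw [Finset.card_insert_of_notMem, Finset.card_image_of_injective _ hmono.injective, hQ] at hcard
  · simp at hcard
  · simp only [Finset.mem_image, Finset.mem_univ, true_and, not_exists]
    intro i hi
    exact (hrx i).ne hi

/-! ### Behaviour at infinity -/

lemma norm_aeval_le (Q : Polynomial ℝ) (n : ℕ) (hQ : Q.natDegree ≤ n) :
    ∃ C : ℝ, 0 ≤ C ∧ ∀ z : ℂ, 1 ≤ ‖z‖ → ‖Polynomial.aeval z Q‖ ≤ C * ‖z‖ ^ n := by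
  refine ⟨∑ i ∈ Finset.range (n + 1), |Q.coeff i|, Finset.sum_nonneg fun _ _ => abs_nonneg _, ?_⟩
  intro z hz
  rw [Polynomial.aeval_eq_sum_range' (Nat.lt_succ_of_le hQ), Finset.sum_mul]
  refine (norm_sum_le _ _).trans (Finset.sum_le_sum fun i hi => ?_)
  rw [norm_smul, norm_pow, Real.norm_eq_abs]
  apply mul_le_mul_of_nonneg_left _ (abs_nonneg _)
  exact pow_le_pow_right₀ hz (by rw [Finset.mem_range] at hi; omega)

lemma bound_infty {N : ℕ} (y : ℕ → ℝ) (x : ℝ) (Q : Polynomial ℝ) (hQ : Q.natDegree ≤ N) :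
    ∃ C R0 : ℝ, 0 ≤ C ∧ 0 < R0 ∧ |x| < R0 ∧ ∀ z : ℂ, R0 ≤ ‖z‖ →
      ‖(Polynomial.aeval z Q / (z - x) ^ 2) / PP (Finset.Icc 1 (2 * N)) y z‖ ≤ C / ‖z‖ ^ 2 := by
  obtain ⟨C, hC, hCz⟩ := norm_aeval_le Q N hQ
  set M : ℝ := ∑ j ∈ Finset.Icc 1 (2 * N), |y j| + |x| + 1 with hM
  have hsum : 0 ≤ ∑ j ∈ Finset.Icc 1 (2 * N), |y j| := Finset.sum_nonneg fun _ _ => abs_nonneg _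
  have hx0 := abs_nonneg x
  refine ⟨C * 2 ^ N * 4, 2 * M, by positivity, by linarith, by linarith, ?_⟩
  intro z hz
  have hz1 : 1 ≤ ‖z‖ := by linarith
  have hz0 : 0 < ‖z‖ := by linarith
  have hhalf : ∀ a : ℝ, |a| ≤ M → ‖z‖ / 2 ≤ ‖z - a‖ := by
    intro a ha
    have h1 := norm_sub_norm_le z (a : ℂ)
    rw [Complex.norm_real, Real.norm_eq_abs] at h1
    linarith
  have hPP : (‖z‖ / 2) ^ N ≤ ‖PP (Finset.Icc 1 (2 * N)) y z‖ := by
    have h2 : (‖z‖ / 2) ^ (2 * N) ≤ ‖PP (Finset.Icc 1 (2 * N)) y z‖ ^ 2 := by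
      unfold PP
      rw [norm_prod, ← Finset.prod_pow]
      calc (‖z‖ / 2) ^ (2 * N) = ∏ j ∈ Finset.Icc 1 (2 * N), (‖z‖ / 2) := by
            rw [Finset.prod_const, Nat.card_Icc, Nat.add_sub_cancel]
        _ ≤ _ := by
          apply Finset.prod_le_prod
          · intros; positivity
          · intro j hj
            have hj' : ‖z‖ / 2 ≤ ‖z - y j‖ := by
              apply hhalf
              have := Finset.single_le_sum (f := fun j => |y j|) (fun _ _ => abs_nonneg _) hj
              linarith
            rw [norm_EE_sq]
            · exact hj'
            · rw [← norm_pos_iff]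
              linarith
    have e : (‖z‖ / 2) ^ (2 * N) = ((‖z‖ / 2) ^ N) ^ 2 := by rw [← pow_mul, mul_comm 2 N]
    rw [e] at h2
    exact le_of_sq_le_sq h2 (norm_nonneg _)
  have hxz : (‖z‖ / 2) ^ 2 ≤ ‖z - x‖ ^ 2 := by
    apply pow_le_pow_left₀ (by positivity)
    apply hhalf
    linarith
  rw [norm_div, norm_div, norm_pow, div_div]
  calc ‖Polynomial.aeval z Q‖ / (‖z - x‖ ^ 2 * ‖PP (Finset.Icc 1 (2 * N)) y z‖)
      ≤ (C * ‖z‖ ^ N) / ((‖z‖ / 2) ^ 2 * (‖z‖ / 2) ^ N) := by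
        apply div_le_div₀ (by positivity) (hCz z hz1) (by positivity)
        exact mul_le_mul hxz hPP (by positivity) (by positivity)
    _ = C * 2 ^ N * 4 / ‖z‖ ^ 2 := by
        rw [div_pow, div_pow]
        field_simp
        ring

lemma infty_eq (V f : ℂ → ℂ) (x : ℝ) (hV1 : ∀ z ∈ UHP, HasDerivAt V (f z) z)
    (hV2 : ContinuousOn V (cUHP \ {(x : ℂ)})) (C R0 : ℝ) (hC : 0 ≤ C) (hR0 : 0 < R0)
    (hxR : |x| < R0) (hb : ∀ z : ℂ, R0 ≤ ‖z‖ → ‖f z‖ ≤ C / ‖z‖ ^ 2)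
    (κ : ℂ) (a b R1 : ℝ) (ha : ∀ R : ℝ, R1 ≤ R → (κ * V R).re = a)
    (hb' : ∀ R : ℝ, R1 ≤ R → (κ * V ((-R : ℝ) : ℂ)).re = b) : a = b := by
  have key : ∀ R : ℝ, max R0 R1 ≤ R → |b - a| ≤ (Real.pi * ‖κ‖ * C) / R := by
    intro R hR
    have hR0' : R0 ≤ R := (le_max_left _ _).trans hR
    have hR1 : R1 ≤ R := (le_max_right _ _).trans hR
    have hRpos : 0 < R := by linarith
    set γ : ℝ → ℂ := fun θ => R * Complex.exp (θ * I) with hγ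
    have hγn : ∀ θ, ‖γ θ‖ = R := by
      intro θ
      simp [hγ, Complex.norm_exp_ofReal_mul_I, abs_of_pos hRpos]
    have hγim : ∀ θ : ℝ, (γ θ).im = R * Real.sin θ := by
      intro θ
      simp [hγ, Complex.exp_ofReal_mul_I_im]
    have hγc : Continuous γ := by fun_prop
    have hγd : ∀ θ : ℝ, HasDerivAt γ (γ θ * I) θ := by
      intro θ
      have h1 : HasDerivAt (fun z : ℂ => (R : ℂ) * Complex.exp (z * I))
          (R * (Complex.exp (θ * I) * (1 * I))) (θ : ℂ) :=
        (((hasDerivAt_id (θ : ℂ)).mul_const I).cexp).const_mul (R : ℂ)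
      refine h1.comp_ofReal.congr_deriv ?_
      simp only [hγ]; ring
    obtain ⟨c, hc, hc'⟩ := exists_hasDerivAt_eq_slope (fun θ : ℝ => (κ * V (γ θ)).re)
      (fun θ => (κ * (f (γ θ) * (γ θ * I))).re) Real.pi_pos
      (by
        apply Complex.continuous_re.comp_continuousOn
        apply ContinuousOn.const_mul
        apply hV2.comp hγc.continuousOn
        intro θ hθ
        refine ⟨?_, ?_⟩
        · change 0 ≤ (γ θ).im
          rw [hγim]
          exact mul_nonneg hRpos.le (Real.sin_nonneg_of_nonneg_of_le_pi hθ.1 hθ.2)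
        · intro h
          have h1 := hγn θ
          rw [mem_singleton_iff.1 h, Complex.norm_real, Real.norm_eq_abs] at h1
          linarith)
      (by
        intro θ hθ
        have hm : γ θ ∈ UHP := by
          change 0 < (γ θ).im
          rw [hγim]
          exact mul_pos hRpos (Real.sin_pos_of_pos_of_lt_pi hθ.1 hθ.2)
        have h1 : HasDerivAt (fun θ : ℝ => V (γ θ)) (f (γ θ) * (γ θ * I)) θ :=
          (hV1 _ hm).comp θ (hγd θ)
        exact hasDerivAt_re (h1.const_mul κ))
    have e1 : γ Real.pi = ((-R : ℝ) : ℂ) := by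
      simp [hγ, Complex.exp_pi_mul_I]
    have e0 : γ 0 = (R : ℂ) := by simp [hγ]
    simp only [e1, e0, ha R hR1, hb' R hR1, sub_zero] at hc'
    have hpi := Real.pi_pos
    have e2 : b - a = Real.pi * (κ * (f (γ c) * (γ c * I))).re := by
      rw [hc']; field_simp
    rw [e2, abs_mul, abs_of_pos hpi]
    have h3 : |(κ * (f (γ c) * (γ c * I))).re| ≤ ‖κ‖ * C / R := by
      refine (Complex.abs_re_le_norm _).trans ?_
      rw [norm_mul, norm_mul, norm_mul, hγn, Complex.norm_I, mul_one]
      have h4 := hb (γ c) (by rw [hγn]; exact hR0')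
      rw [hγn] at h4
      calc ‖κ‖ * (‖f (γ c)‖ * R) ≤ ‖κ‖ * (C / R ^ 2 * R) := by gcongr
        _ = ‖κ‖ * C / R := by field_simp
    calc Real.pi * |(κ * (f (γ c) * (γ c * I))).re| ≤ Real.pi * (‖κ‖ * C / R) := by gcongr
      _ = _ := by ring
  have hlim : Tendsto (fun R : ℝ => (Real.pi * ‖κ‖ * C) / R) atTop (𝓝 0) :=
    tendsto_const_nhds.div_atTop tendsto_id
  have h0 : |b - a| ≤ 0 := by
    apply ge_of_tendsto hlim
    filter_upwards [eventually_ge_atTop (max R0 R1)] with R hR using key R hR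
  have := abs_nonpos_iff.1 h0
  linarith

/-! ### Behaviour near `x` -/

lemma near_x (V G : ℂ → ℂ) (x : ℝ) (hG : ∀ᶠ u in 𝓝 (x : ℂ), DifferentiableAt ℂ G u)
    (hV : ∀ z ∈ UHP, HasDerivAt V (G z / (z - x) ^ 2) z) :
    ∃ r > 0, ∃ M : ℂ → ℂ, ContinuousOn M (ball (x : ℂ) r) ∧ ∀ z ∈ ball (x : ℂ) r ∩ UHP,
      V z = - G x / (z - x) + deriv G x * Complex.log (-I * (z - x)) + M z := by
  obtain ⟨r, hr, hball⟩ := Metric.eventually_nhds_iff_ball.1 hG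
  have hd : DifferentiableOn ℂ G (ball (x : ℂ) r) := fun z hz =>
    (hball z hz).differentiableWithinAt
  have hn : ball (x : ℂ) r ∈ 𝓝 (x : ℂ) := isOpen_ball.mem_nhds (mem_ball_self hr)
  have hd1 := (Complex.differentiableOn_dslope hn).2 hd
  have hd2 := (Complex.differentiableOn_dslope hn).2 hd1
  obtain ⟨M, hM⟩ := hd2.isExactOn_ball
  obtain ⟨c, hc⟩ := eq_add_const V
    (fun z => - G x * (z - x)⁻¹ + deriv G x * Complex.log (-I * (z - x)) + M z)
    (fun z => G z / (z - x) ^ 2) (ball (x : ℂ) r ∩ UHP)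
    ((convex_ball _ r).inter UHP_convex) (isOpen_ball.inter UHP_isOpen)
    (fun z hz => hV z hz.2) (fun z hz => by
      have hzx : z - x ≠ 0 := sub_ne_zero.2 (UHP_ne_real z hz.2 x)
      have hzim : 0 < z.im := hz.2
      have h1 : HasDerivAt (fun z : ℂ => z - x) 1 z := (hasDerivAt_id z).sub_const (x : ℂ)
      have h2 := (h1.inv hzx).const_mul (- G x)
      have h3 := ((h1.const_mul (-I)).clog (slit_of (z - x)
        (Or.inl (by simpa using hzim)))).const_mul (deriv G x)
      refine ((h2.add h3).add (hM z hz.1)).congr_deriv ?_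
      have e1 := sub_smul_dslope G (x : ℂ) z
      have e2 := sub_smul_dslope (dslope G (x : ℂ)) (x : ℂ) z
      rw [dslope_same, smul_eq_mul] at e2
      rw [smul_eq_mul] at e1
      have e3 : G z = G x + (z - x) * deriv G x + (z - x) ^ 2 *
          dslope (dslope G (x : ℂ)) (x : ℂ) z := by
        linear_combination -e1 - (z - x) * e2
      rw [e3]
      field_simp
      try ring)
  refine ⟨r, hr, fun z => M z + c, ?_, fun z hz => ?_⟩
  · intro z hz
    exact ((hM z hz).continuousAt.add continuousAt_const).continuousWithinAt
  · rw [hc z hz]; ring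

lemma I_pow_even {m : ℕ} (h : Even m) : ∃ σ : ℝ, (I : ℂ) ^ m = σ := by
  obtain ⟨n, rfl⟩ := h
  refine ⟨(-1) ^ n, ?_⟩
  rw [← two_mul, pow_mul, I_sq]
  push_cast
  rfl

lemma I_pow_odd {m : ℕ} (h : Odd m) : ∃ σ : ℝ, (I : ℂ) ^ m = I * σ := by
  obtain ⟨n, rfl⟩ := h
  refine ⟨(-1) ^ n, ?_⟩
  rw [pow_succ, pow_mul, I_sq]
  push_cast
  ring

lemma y_mono {N : ℕ} {y : ℕ → ℝ} (hy : ∀ i j : ℕ, 1 ≤ i → i < j → j ≤ 2 * N → y i < y j)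
    {i j : ℕ} (h1 : 1 ≤ i) (h2 : i ≤ j) (h3 : j ≤ 2 * N) : y i ≤ y j := by
  rcases h2.eq_or_lt with rfl | h
  · exact le_rfl
  · exact (hy i j h1 h h3).le

lemma arg_left (p x : ℝ) (h : p < x) : (Complex.log (-I * ((p : ℂ) - x))).im = Real.pi / 2 := by
  have : -I * ((p : ℂ) - x) = ((x - p : ℝ) : ℂ) * I := by push_cast; ring
  rw [Complex.log_im, this, Complex.arg_real_mul _ (by linarith), Complex.arg_I]

lemma arg_right (p x : ℝ) (h : x < p) :
    (Complex.log (-I * ((p : ℂ) - x))).im = -(Real.pi / 2) := by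
  have : -I * ((p : ℂ) - x) = ((p - x : ℝ) : ℂ) * (-I) := by push_cast; ring
  rw [Complex.log_im, this, Complex.arg_real_mul _ (by linarith), Complex.arg_neg_I]

lemma neBot_real (p : ℝ) : (𝓝[UHP] (p : ℂ)).NeBot :=
  mem_closure_iff_nhdsWithin_neBot.1 (cUHP_subset_closure (ofReal_mem_cUHP p))

theorem aux_function_V (N : ℕ) (hN : 3 ≤ N) (y : ℕ → ℝ)
    (hy : ∀ i j : ℕ, 1 ≤ i → i < j → j ≤ 2 * N → y i < y j)
    (x : ℝ) (hx : x ∈ Set.Ioo (y (2 * N - 1)) (y (2 * N)))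
    (Q : Polynomial ℝ) (hQmonic : Q.Monic) (hQdeg : Q.natDegree = N - 2)
    (hQorth : ∀ i : Fin (N - 2),
      (∫ u in (y (2 * (i : ℕ) + 3))..(y (2 * (i : ℕ) + 4)),
        (Polynomial.aeval (u : ℂ) Q) / (sqrtProd N y u * ((u : ℂ) - (x : ℂ)) ^ 2)) = 0) :
    -- `g(u) = Q̃(u)/Π(u)`, `L = g'(x)/g(x)` (derivative within the closed upper half-plane)
    let g : ℂ → ℂ := fun u => (Polynomial.aeval u Q) / sqrtProd N y u
    let L : ℂ := derivWithin g cUHP (x : ℂ) / g (x : ℂ)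
    -- (0) `L` is a real number
    L.im = 0 ∧
    -- `V` exists: a holomorphic primitive of `g(u)/(π g(x)(u-x)²)` on ℍ vanishing at `y₁`,
    -- satisfying the boundary conditions (1)-(4)
    (∃ V : ℂ → ℂ,
      (DifferentiableOn ℂ V UHP ∧
        (∀ z ∈ UHP, HasDerivAt V (g z / ((Real.pi : ℂ) * g (x : ℂ) * (z - (x : ℂ)) ^ 2)) z) ∧
        Tendsto V (𝓝[UHP] ((y 1 : ℝ) : ℂ)) (𝓝 0)) ∧
      -- (1) Im V is constant on each (y_{2i-1}, y_{2i}), 1 ≤ i ≤ N-1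
      (∀ i : ℕ, 1 ≤ i → i ≤ N - 1 → ∃ c : ℝ,
        ∀ p ∈ Set.Ioo (y (2 * i - 1)) (y (2 * i)),
          Tendsto (fun z => (V z).im) (𝓝[UHP] (p : ℂ)) (𝓝 c)) ∧
      -- (2) Re V = 0 on (-∞,y₁) ∪ (y_{2N},∞) and equals one common constant on all
      -- (y_{2i}, y_{2i+1}), 1 ≤ i ≤ N-1
      (∀ p : ℝ, (p < y 1 ∨ y (2 * N) < p) →
        Tendsto (fun z => (V z).re) (𝓝[UHP] (p : ℂ)) (𝓝 0)) ∧
      (∃ c : ℝ, ∀ i : ℕ, 1 ≤ i → i ≤ N - 1 →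
        ∀ p ∈ Set.Ioo (y (2 * i)) (y (2 * i + 1)),
          Tendsto (fun z => (V z).re) (𝓝[UHP] (p : ℂ)) (𝓝 c)) ∧
      -- (3) Im (V(z) + 1/(π(z-x))) is bounded near x
      (∃ r > 0, ∃ C : ℝ, ∀ z ∈ UHP ∩ ball ((x : ℝ) : ℂ) r,
        |(V z + 1 / ((Real.pi : ℂ) * (z - (x : ℂ)))).im| ≤ C) ∧
      -- (4) Im (V(z) + 1/(π(z-x))) has constant boundary values K₁ on (y_{2N-1}, x) and
      -- K₂ on (x, y_{2N}), with K₁ = K₂ + L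
      (∃ K₁ K₂ : ℝ,
        (∀ p ∈ Set.Ioo (y (2 * N - 1)) x,
          Tendsto (fun z => (V z + 1 / ((Real.pi : ℂ) * (z - (x : ℂ)))).im)
            (𝓝[UHP] (p : ℂ)) (𝓝 K₁)) ∧
        (∀ p ∈ Set.Ioo x (y (2 * N)),
          Tendsto (fun z => (V z + 1 / ((Real.pi : ℂ) * (z - (x : ℂ)))).im)
            (𝓝[UHP] (p : ℂ)) (𝓝 K₂)) ∧
        (K₁ : ℂ) = (K₂ : ℂ) + L)) := by
  intro g L
  set S := Finset.Icc 1 (2 * N) with hS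
  have hxy : ∀ i ∈ S, y i ≠ x := by
    intro i hi
    rw [Finset.mem_Icc] at hi
    rcases Nat.lt_or_ge i (2 * N) with h | h
    · have := y_mono hy (i := i) (j := 2 * N - 1) hi.1 (by omega) (by omega)
      exact (lt_of_le_of_lt this hx.1).ne
    · have : i = 2 * N := by omega
      subst this
      exact hx.2.ne'
  have hN1 : 2 * N - 1 + 1 = 2 * N := by omega
  have hgapx : ∀ p ∈ Ioo (y (2 * N - 1)) (y (2 * N)), Gap N y (2 * N - 1) p := by
    intro p hp
    refine gap_Ioo hy (k := 2 * N - 1) (by omega) (by omega) ?_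
    rwa [hN1]
  have hxlt : ∀ k, 1 ≤ k → k ≤ 2 * N - 1 → y k < x := fun k h1 h2 =>
    lt_of_le_of_lt (y_mono hy h1 h2 (by omega)) hx.1
  set H : ℂ → ℂ := fun u => Polynomial.aeval u Q / (u - x) ^ 2 with hHdef
  have hQd : Differentiable ℂ (fun u : ℂ => Polynomial.aeval u Q) := Polynomial.differentiable_aeval Q
  have hH : DifferentiableOn ℂ H {(x : ℂ)}ᶜ := by
    apply DifferentiableOn.div hQd.differentiableOn (by fun_prop)
    intro u hu
    exact pow_ne_zero _ (sub_ne_zero.2 hu)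
  obtain ⟨V0, hV1, hV2, hV3⟩ := main_primitive S y (y_inj hy) x hxy H hH
  -- orthogonality
  have horth : ∀ i : Fin (N - 2), V0 (y (2 * (i : ℕ) + 4)) = V0 (y (2 * (i : ℕ) + 3)) := by
    intro i
    have hi := i.2
    have h := ftc_gap hy (k := 2 * (i : ℕ) + 3) (by omega) (by omega) x hxy
      (fun hc => absurd hc.2 (not_le.2 (hxlt _ (by omega) (by omega)))) H V0 hH.continuousOn hV2 hV3
    have h2 := hQorth i
    have e : ∀ u : ℝ, (Polynomial.aeval (u : ℂ) Q) / (sqrtProd N y u * ((u : ℂ) - (x : ℂ)) ^ 2) =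
        H u / sqrtProd N y u := by
      intro u
      simp only [hHdef]
      rw [div_div, mul_comm]
    simp only [e] at h2
    rw [show 2 * (i : ℕ) + 4 = 2 * (i : ℕ) + 3 + 1 from rfl] at h2 ⊢
    rw [h2] at h
    exact (sub_eq_zero.1 h.symm)
  have hQx : Q.eval x ≠ 0 := by
    refine Q_ne_zero hN hy x hx.1 Q hQmonic.ne_zero hQdeg ?_
    intro i
    have hi := i.2
    exact root_gap hy (k := 2 * (i : ℕ) + 3) (by omega) (by omega) x
      (fun hc => absurd hc.2 (not_le.2 (hxlt _ (by omega) (by omega)))) Q V0 hV2 hV3 (horth i)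
  -- the function `G`
  set G : ℂ → ℂ := fun u => Polynomial.aeval u Q / PP S y u with hGdef
  have hgG : ∀ u ∈ cUHP, (∀ j ∈ S, u ≠ (y j : ℂ)) → g u = G u := by
    intro u hu hj
    simp only [g, hGdef]
    rw [sqrtProd_eq N y u hu hj]
  have hxyc : ∀ j ∈ S, (x : ℂ) ≠ (y j : ℂ) := by
    intro j hj
    exact_mod_cast (hxy j hj).symm
  have hgx : g x = G x := hgG x (ofReal_mem_cUHP x) hxyc
  have hGreal : ∀ p ∈ Ioo (y (2 * N - 1)) (y (2 * N)),
      G p = -I * ((Q.eval p / RR N y p : ℝ) : ℂ) := by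
    intro p hp
    simp only [hGdef]
    rw [PP_real (hgapx p hp), aeval_real, show 2 * N - (2 * N - 1) = 1 by omega, pow_one]
    push_cast
    rw [mul_comm I, ← div_div, Complex.div_I]
    ring
  set q : ℝ := Q.eval x / RR N y x with hq
  have hGx : G x = -I * (q : ℂ) := hGreal x hx
  have hq0 : q ≠ 0 := div_ne_zero hQx (RR_pos (hgapx x hx).ne).ne'
  have hGev : ∀ᶠ u in 𝓝 (x : ℂ), DifferentiableAt ℂ G u := by
    filter_upwards [good_eventually S y x (ofReal_mem_cUHP x) hxyc] with w h1
    exact (hQd w).div (PP_diff S y w h1) (PP_ne S y w)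
  have hGd : HasDerivAt G (deriv G x) x := hGev.self_of_nhds.hasDerivAt
  set d : ℂ := deriv G x with hd
  have hgd : derivWithin g cUHP (x : ℂ) = d := by
    have h1 : HasDerivWithinAt g d cUHP (x : ℂ) := by
      apply hGd.hasDerivWithinAt.congr_of_eventuallyEq _ hgx
      have : ∀ᶠ u in 𝓝 (x : ℂ), ∀ j ∈ S, u ≠ (y j : ℂ) := by
        rw [Finset.eventually_all]
        intro j hj
        exact isOpen_ne.mem_nhds (hxyc j hj)
      filter_upwards [self_mem_nhdsWithin, nhdsWithin_le_nhds this] with u h1 h2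
      exact hgG u h1 h2
    apply h1.derivWithin
    apply uniqueDiffWithinAt_convex_of_isRCLikeNormedField cUHP_convex
    · refine ⟨I, ?_⟩
      apply interior_mono (show UHP ⊆ cUHP from fun z hz => le_of_lt (show 0 < z.im from hz))
      rw [UHP_isOpen.interior_eq]
      simp [UHP]
    · exact subset_closure (ofReal_mem_cUHP x)
  have hdre : d.re = 0 := by
    have h1 := hasDerivAt_re hGd.comp_ofReal
    have h2 : HasDerivAt (fun t : ℝ => (G t).re) 0 x := by
      apply (hasDerivAt_const x (0 : ℝ)).congr_of_eventuallyEq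
      filter_upwards [isOpen_Ioo.mem_nhds hx] with p hp
      rw [hGreal p hp]
      simp
    exact h1.unique h2
  set l : ℝ := - d.im / q with hl
  have hLl : L = (l : ℂ) := by
    simp only [L]
    rw [hgd, hgx, hGx]
    have : d = (d.im : ℂ) * I := by
      apply Complex.ext <;> simp [hdre]
    rw [this]
    simp only [hl]
    have hqc : (q : ℂ) ≠ 0 := by exact_mod_cast hq0
    have hI := I_ne_zero
    push_cast
    simp
    field_simp
  have hLG : d = (l : ℂ) * G x := by
    have h0 : G x ≠ 0 := by
      rw [hGx]
      exact mul_ne_zero (by simp) (by exact_mod_cast hq0)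
    rw [← hLl]
    simp only [L]
    rw [hgd, hgx]
    field_simp
  refine ⟨by rw [hLl]; simp, ?_⟩
  have hpi : (Real.pi : ℂ) ≠ 0 := by exact_mod_cast Real.pi_ne_zero
  have hGx0 : G x ≠ 0 := by
    rw [hGx]
    exact mul_ne_zero (by simp) (by exact_mod_cast hq0)
  set κ : ℂ := 1 / (Real.pi * G x) with hκ
  have hκr : κ = I * ((1 / (Real.pi * q) : ℝ) : ℂ) := by
    rw [hκ, hGx]
    have hqc : (q : ℂ) ≠ 0 := by exact_mod_cast hq0
    push_cast
    field_simp
    simp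
  set V : ℂ → ℂ := fun z => κ * (V0 z - V0 (y 1)) with hVdef
  have hVc : ContinuousOn V (cUHP \ {(x : ℂ)}) := (hV2.sub continuousOn_const).const_mul κ
  have hVU : ∀ z ∈ UHP, HasDerivAt V (g z / ((Real.pi : ℂ) * g (x : ℂ) * (z - (x : ℂ)) ^ 2)) z := by
    intro z hz
    refine (((hV1 z hz).sub_const (V0 (y 1))).const_mul κ).congr_deriv ?_
    rw [hgx, hgG z (le_of_lt (show 0 < z.im from hz)) (fun j _ => UHP_ne_real z hz (y j))]
    simp only [hHdef, hGdef, hκ]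
    field_simp
  have hT : ∀ p : ℝ, p ≠ x → Tendsto V (𝓝[UHP] (p : ℂ)) (𝓝 (V p)) := by
    intro p hp
    have h1 := hVc p ⟨ofReal_mem_cUHP p, by simpa using hp⟩
    refine h1.mono_left (nhdsWithin_mono _ ?_)
    intro z hz
    exact ⟨le_of_lt (show 0 < z.im from hz), UHP_ne_real z hz x⟩
  have hVr : ∀ p : ℝ, p ≠ x → (∀ j ∈ S, p ≠ y j) →
      HasDerivAt (fun t : ℝ => V t) (κ * (H p / PP S y p)) p := by
    intro p h1 h2
    exact ((hV3 p h1 h2).sub_const (V0 (y 1))).const_mul κ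
  have hre : ∀ (k : ℕ) (p : ℝ), k ≤ 2 * N → Even k → Gap N y k p → p ≠ x →
      HasDerivAt (fun t : ℝ => (V t).re) 0 p := by
    intro k p hk hke hg hpx
    refine (hasDerivAt_re (hVr p hpx hg.ne)).congr_deriv ?_
    obtain ⟨σ, hσ⟩ := I_pow_even (m := 2 * N - k) (by
      rw [Nat.even_sub hk]; simp [hke])
    rw [PP_real hg, hσ, hκr]
    simp only [hHdef]
    rw [aeval_real]
    have : I * ((1 / (Real.pi * q) : ℝ) : ℂ) * ((Q.eval p : ℝ) / ((p : ℂ) - x) ^ 2 /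
        (σ * (RR N y p : ℂ))) =
        I * ((1 / (Real.pi * q) * (Q.eval p / (p - x) ^ 2 / (σ * RR N y p)) : ℝ) : ℂ) := by
      push_cast
      ring
    rw [this]
    exact (Complex.re_mul_ofReal I _).trans (by simp)
  have him : ∀ (k : ℕ) (p : ℝ), k ≤ 2 * N → Odd k → Gap N y k p → p ≠ x →
      HasDerivAt (fun t : ℝ => (V t).im) 0 p := by
    intro k p hk hke hg hpx
    refine (hasDerivAt_im (hVr p hpx hg.ne)).congr_deriv ?_
    obtain ⟨σ, hσ⟩ := I_pow_odd (m := 2 * N - k) (by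
      grind)
    rw [PP_real hg, hσ, hκr]
    simp only [hHdef]
    rw [aeval_real]
    have : I * ((1 / (Real.pi * q) : ℝ) : ℂ) * ((Q.eval p : ℝ) / ((p : ℂ) - x) ^ 2 /
        (I * σ * (RR N y p : ℂ))) =
        ((1 / (Real.pi * q) * (Q.eval p / (p - x) ^ 2 / (σ * RR N y p)) : ℝ) : ℂ) := by
      push_cast
      rw [mul_assoc I (σ : ℂ), mul_comm I ((σ : ℂ) * _), ← div_div _ _ I, Complex.div_I]
      linear_combination (-(1 / (Real.pi * q) * (Q.eval p / (p - x) ^ 2 / (σ * RR N y p))) : ℂ) * I_sq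
    rw [this, Complex.ofReal_im]
  have hVre : ∀ s : Set ℝ, x ∉ s → ContinuousOn (fun t : ℝ => (V t).re) s := fun s hs =>
    Complex.continuous_re.comp_continuousOn (cont_real hVc s hs)
  have hVim : ∀ s : Set ℝ, x ∉ s → ContinuousOn (fun t : ℝ => (V t).im) s := fun s hs =>
    Complex.continuous_im.comp_continuousOn (cont_real hVc s hs)
  have hVy1 : V (y 1) = 0 := by simp [hVdef]
  have hTre : ∀ p : ℝ, p ≠ x → Tendsto (fun z => (V z).re) (𝓝[UHP] (p : ℂ)) (𝓝 (V p).re) :=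
    fun p hp => (Complex.continuous_re.tendsto _).comp (hT p hp)
  have hTim : ∀ p : ℝ, p ≠ x → Tendsto (fun z => (V z).im) (𝓝[UHP] (p : ℂ)) (𝓝 (V p).im) :=
    fun p hp => (Complex.continuous_im.tendsto _).comp (hT p hp)
  -- left outer interval
  have hleft : ∀ p : ℝ, p < y 1 → (V p).re = 0 := by
    intro p hp
    have h1x := hxlt 1 (by omega) (by omega)
    have := const_of_deriv (fun t : ℝ => (V t).re) p (y 1) hp.le
      (hVre _ (fun h => absurd h.2 (not_le.2 h1x)))
      (fun t ht => hre 0 t (by omega) (by simp) (gap_left hy ht.2) (ht.2.trans h1x).ne)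
    rw [← this, hVy1]
    simp
  have hright : ∀ p : ℝ, y (2 * N) ≤ p → (V p).re = (V (y (2 * N))).re := by
    intro p hp
    exact const_of_deriv (fun t : ℝ => (V t).re) (y (2 * N)) p hp
      (hVre _ (fun h => absurd h.1 (not_le.2 hx.2)))
      (fun t ht => hre (2 * N) t le_rfl (by simp) (gap_right hy ht.1) (hx.2.trans ht.1).ne')
  have hinf : (V (y (2 * N))).re = 0 := by
    obtain ⟨C, R0, hC, hR0, hxR, hb⟩ := bound_infty (N := N) y x Q (by omega)
    set e : ℝ := (κ * V0 (y 1)).re with he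
    have hVe : ∀ z, (κ * V0 z).re = (V z).re + e := by
      intro z
      simp only [hVdef, he]
      rw [mul_sub, Complex.sub_re]
      ring
    have := infty_eq V0 (fun z => H z / PP S y z) x hV1 hV2 C R0 hC hR0 hxR hb κ
      ((V (y (2 * N))).re + e) e (max (y (2 * N)) (-(y 1) + 1))
      (fun R hR => by
        rw [hVe, hright R ((le_max_left _ _).trans hR)])
      (fun R hR => by
        have : -(y 1) + 1 ≤ R := (le_max_right _ _).trans hR
        rw [hVe, hleft (-R) (by linarith)]
        simp)
    linarith
  refine ⟨V, ⟨fun z hz => (hVU z hz).differentiableAt.differentiableWithinAt, hVU, ?_⟩,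
    ?_, ?_, ?_, ?_, ?_⟩
  · have := hT (y 1) (hxlt 1 (by omega) (by omega)).ne
    rwa [hVy1] at this
  · -- (1)
    intro i h1 h2
    refine ⟨(V (y (2 * i - 1))).im, fun p hp => ?_⟩
    have hpx : p < x := hp.2.trans (hxlt (2 * i) (by omega) (by omega))
    have e := const_of_deriv (fun t : ℝ => (V t).im) (y (2 * i - 1)) p hp.1.le
      (hVim _ (fun h => absurd h.2 (not_le.2 hpx)))
      (fun t ht => him (2 * i - 1) t (by omega) ⟨i - 1, by omega⟩
        (gap_Ioo hy (by omega) (by omega)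
          (by rw [show 2 * i - 1 + 1 = 2 * i by omega]; exact ⟨ht.1, ht.2.trans hp.2⟩))
        (ht.2.trans hpx).ne)
    rw [← e]
    exact hTim p hpx.ne
  · -- (2) outer
    intro p hp
    rcases hp with hp | hp
    · have := hTre p (hp.trans (hxlt 1 (by omega) (by omega))).ne
      rwa [hleft p hp] at this
    · have := hTre p (hx.2.trans hp).ne'
      rwa [hright p hp.le, hinf] at this
  · -- (2) inner
    have hconst : ∀ i : ℕ, 1 ≤ i → i ≤ N - 1 → ∀ p ∈ Icc (y (2 * i)) (y (2 * i + 1)), p < x →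
        (V p).re = (V (y (2 * i))).re := by
      intro i h1 h2 p hp hpx
      exact const_of_deriv (fun t : ℝ => (V t).re) (y (2 * i)) p hp.1
        (hVre _ (fun h => absurd h.2 (not_le.2 hpx)))
        (fun t ht => hre (2 * i) t (by omega) (by simp)
          (gap_Ioo hy (by omega) (by omega) ⟨ht.1, ht.2.trans_le hp.2⟩) (ht.2.trans hpx).ne)
    have hind : ∀ i : ℕ, 1 ≤ i → i ≤ N - 1 → (V (y (2 * i))).re = (V (y 2)).re := by
      intro i h1
      induction i, h1 using Nat.le_induction with
      | base => intro _; rfl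
      | succ i h1 ih =>
        intro h2
        rw [← ih (by omega), ← hconst i h1 (by omega) (y (2 * i + 1))
          ⟨(hy _ _ (by omega) (by omega) (by omega)).le, le_rfl⟩ (hxlt _ (by omega) (by omega))]
        have := horth ⟨i - 1, by omega⟩
        simp only at this
        rw [show 2 * (i - 1) + 4 = 2 * (i + 1) by omega,
          show 2 * (i - 1) + 3 = 2 * i + 1 by omega] at this
        simp only [hVdef]
        rw [this]
    refine ⟨(V (y 2)).re, fun i h1 h2 p hp => ?_⟩
    have hpx : p < x := hp.2.trans_le (hxlt (2 * i + 1) (by omega) (by omega)).le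
    rw [← hind i h1 h2, ← hconst i h1 h2 p (Ioo_subset_Icc_self hp) hpx]
    exact hTre p hpx.ne
  all_goals
    obtain ⟨r, hr, M, hM, hMV⟩ := near_x V0 G x hGev (by
      intro z hz
      refine (hV1 z hz).congr_deriv ?_
      simp only [hHdef, hGdef]
      rw [div_div, div_div, mul_comm])
    set M2 : ℂ → ℂ := fun z => κ * (M z - V0 (y 1)) with hM2
    have hM2c : ContinuousOn M2 (ball (x : ℂ) r) := (hM.sub continuousOn_const).const_mul κ
    have hform : ∀ z ∈ ball (x : ℂ) r ∩ UHP, V z + 1 / ((Real.pi : ℂ) * (z - (x : ℂ))) =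
        ((l / Real.pi : ℝ) : ℂ) * Complex.log (-I * (z - x)) + M2 z := by
      intro z hz
      have hzx : z - x ≠ 0 := sub_ne_zero.2 (UHP_ne_real z hz.2 x)
      simp only [hVdef, hM2]
      rw [hMV z hz, ← hd, hLG, hκ]
      push_cast
      field_simp
      ring
    have hn : ball (x : ℂ) r ∈ 𝓝 (x : ℂ) := isOpen_ball.mem_nhds (mem_ball_self hr)
    have hM2x : ContinuousAt M2 x := hM2c.continuousAt hn
  · -- (3)
    obtain ⟨r', hr', hr2⟩ := Metric.eventually_nhds_iff_ball.1
      ((hM2x.eventually (isOpen_ball.mem_nhds (mem_ball_self one_pos))).and hn)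
    refine ⟨r', hr', |l / Real.pi| * Real.pi + (‖M2 x‖ + 1), fun z hz => ?_⟩
    obtain ⟨h1, h2⟩ := hr2 z hz.2
    rw [hform z ⟨h2, hz.1⟩, Complex.add_im, Complex.im_ofReal_mul]
    refine (abs_add_le _ _).trans (add_le_add ?_ ?_)
    · rw [abs_mul, Complex.log_im]
      exact mul_le_mul_of_nonneg_left (Complex.abs_arg_le_pi _) (abs_nonneg _)
    · refine (Complex.abs_im_le_norm _).trans ?_
      have h3 : ‖M2 z - M2 x‖ < 1 := by simpa [dist_eq_norm] using h1
      have h4 := norm_sub_norm_le (M2 z) (M2 x)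
      linarith
  · -- (4)
    have hT2 : ∀ p : ℝ, p ≠ x → Tendsto (fun z => V z + 1 / ((Real.pi : ℂ) * (z - (x : ℂ))))
        (𝓝[UHP] (p : ℂ)) (𝓝 (V p + 1 / ((Real.pi : ℂ) * ((p : ℂ) - (x : ℂ))))) := by
      intro p hp
      have hpc : (p : ℂ) - x ≠ 0 := sub_ne_zero.2 (by exact_mod_cast hp)
      apply (hT p hp).add
      have hc : ContinuousAt (fun z : ℂ => 1 / ((Real.pi : ℂ) * (z - (x : ℂ)))) (p : ℂ) := by
        exact ContinuousAt.div (f := fun _ : ℂ => (1:ℂ)) (g := fun z : ℂ => (Real.pi : ℂ) * (z - (x : ℂ))) continuousAt_const (by fun_prop) (mul_ne_zero hpi hpc)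
      exact hc.tendsto.mono_left nhdsWithin_le_nhds
    have himeq : ∀ p : ℝ, (V p + 1 / ((Real.pi : ℂ) * ((p : ℂ) - (x : ℂ)))).im = (V p).im := by
      intro p
      have : 1 / ((Real.pi : ℂ) * ((p : ℂ) - (x : ℂ))) = ((1 / (Real.pi * (p - x)) : ℝ) : ℂ) := by
        push_cast; rfl
      rw [this, Complex.add_im, Complex.ofReal_im, add_zero]
    have hT3 : ∀ p : ℝ, p ≠ x →
        Tendsto (fun z => (V z + 1 / ((Real.pi : ℂ) * (z - (x : ℂ)))).im)
        (𝓝[UHP] (p : ℂ)) (𝓝 (V p).im) := by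
      intro p hp
      rw [← himeq p]
      exact (Complex.continuous_im.tendsto _).comp (hT2 p hp)
    have hK1 : ∀ p ∈ Ioo (y (2 * N - 1)) x, (V p).im = (V (y (2 * N - 1))).im := by
      intro p hp
      exact const_of_deriv (fun t : ℝ => (V t).im) (y (2 * N - 1)) p hp.1.le
        (hVim _ (fun h => absurd h.2 (not_le.2 hp.2)))
        (fun t ht => him (2 * N - 1) t (by omega) ⟨N - 1, by omega⟩
          (hgapx t ⟨ht.1, ht.2.trans (hp.2.trans hx.2)⟩) (ht.2.trans hp.2).ne)
    have hK2 : ∀ p ∈ Ioo x (y (2 * N)), (V p).im = (V (y (2 * N))).im := by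
      intro p hp
      exact (const_of_deriv (fun t : ℝ => (V t).im) p (y (2 * N)) hp.2.le
        (hVim _ (fun h => absurd h.1 (not_le.2 hp.1)))
        (fun t ht => him (2 * N - 1) t (by omega) ⟨N - 1, by omega⟩
          (hgapx t ⟨hx.1.trans (hp.1.trans ht.1), ht.2⟩) (hp.1.trans ht.1).ne')).symm
    have hval : ∀ p : ℝ, p ≠ x → (p : ℂ) ∈ ball (x : ℂ) r →
        (V p).im = l / Real.pi * (Complex.log (-I * ((p : ℂ) - x))).im + (M2 p).im := by
      intro p hp hpb
      have h1 : ContinuousAt (fun z : ℂ =>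
          ((l / Real.pi : ℝ) : ℂ) * Complex.log (-I * (z - x)) + M2 z) (p : ℂ) := by
        apply ContinuousAt.add
        · apply ContinuousAt.mul continuousAt_const
          apply ContinuousAt.clog (by fun_prop)
          apply slit_of
          right
          simpa using sub_ne_zero.2 hp
        · exact hM2c.continuousAt (isOpen_ball.mem_nhds hpb)
      have h2 := h1.tendsto.mono_left (nhdsWithin_le_nhds (s := UHP))
      haveI := neBot_real p
      have h3 := tendsto_nhds_unique_of_eventuallyEq (hT2 p hp) h2 (by
        filter_upwards [self_mem_nhdsWithin, nhdsWithin_le_nhds (isOpen_ball.mem_nhds hpb)]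
          with z hz1 hz2
        exact hform z ⟨hz2, hz1⟩)
      have h4 := congrArg Complex.im h3
      rw [himeq, Complex.add_im, Complex.im_ofReal_mul] at h4
      exact h4
    have hMr : ContinuousAt (fun t : ℝ => (M2 t).im) x :=
      Complex.continuous_im.continuousAt.comp
        (ContinuousAt.comp (g := M2) hM2x Complex.continuous_ofReal.continuousAt)
    have hbr : ∀ᶠ t : ℝ in 𝓝 x, (t : ℂ) ∈ ball (x : ℂ) r :=
      Complex.continuous_ofReal.continuousAt.eventually hn
    have hpi' := Real.pi_ne_zero
    have hlim1 : (V (y (2 * N - 1))).im = l / 2 + (M2 x).im := by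
      have h1 : Tendsto (fun t : ℝ => l / 2 + (M2 t).im) (𝓝[<] x) (𝓝 (l / 2 + (M2 x).im)) :=
        (hMr.tendsto.mono_left nhdsWithin_le_nhds).const_add _
      refine tendsto_nhds_unique_of_eventuallyEq tendsto_const_nhds h1 ?_
      filter_upwards [Ioo_mem_nhdsLT hx.1, nhdsWithin_le_nhds hbr] with t ht1 ht2
      rw [← hK1 t ht1, hval t ht1.2.ne ht2, arg_left t x ht1.2]
      field_simp
    have hlim2 : (V (y (2 * N))).im = -(l / 2) + (M2 x).im := by
      have h1 : Tendsto (fun t : ℝ => -(l / 2) + (M2 t).im) (𝓝[>] x)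
          (𝓝 (-(l / 2) + (M2 x).im)) :=
        (hMr.tendsto.mono_left nhdsWithin_le_nhds).const_add _
      refine tendsto_nhds_unique_of_eventuallyEq tendsto_const_nhds h1 ?_
      filter_upwards [Ioo_mem_nhdsGT hx.2, nhdsWithin_le_nhds hbr] with t ht1 ht2
      rw [← hK2 t ht1, hval t ht1.1.ne' ht2, arg_right t x ht1.1]
      field_simp
    refine ⟨(V (y (2 * N - 1))).im, (V (y (2 * N))).im, fun p hp => ?_, fun p hp => ?_, ?_⟩
    · rw [← hK1 p hp]
      exact hT3 p hp.2.ne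
    · rw [← hK2 p hp]
      exact hT3 p hp.1.ne'
    · rw [hLl, hlim1, hlim2]
      push_cast
      ring
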